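/- (Dual gap bound at approximate stationarity.) Let ρ > 1 with Hölder conjugate s, let μ, ν be distributions with positive weights on disjoint point sets {x_1,…,x_n}, {y_1,…,y_m} ⊂ ℝ^d. For (α, β) ∈ ℝ^{n+m} define η_i = s·C_s·Σ_j ν_j·((α_i − β_j)^+)^{s−1}/‖x_i − y_j‖₂^s and ξ_j = s·C_s·Σ_i μ_i·((α_i − β_j)^+)^{s−1}/‖x_i − y_j‖₂^s. Then for any (α*, β*) ∈ ℝ^{n+m}: g(α*, β*) − g(α, β) ≤ (‖α‖_∞ + ‖α*‖_∞)·Σ_i μ_i·|1 − η_i| + (‖β‖_∞ + ‖β*‖_∞)·Σ_j ν_j·|1 − ξ_j|. -/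

import Mathlib

open Finset

noncomputable section

/-- The constant `C_s = (1/s)(1 − 1/s)^{s−1}`. -/
def Cs (s : ℝ) : ℝ := (1 / s) * (1 - 1 / s) ^ (s - 1)

/-- The dual objective `g(α, β)` for `R_ρ(μ, ν)^ρ`, with `s` the Hölder conjugate of `ρ`. -/
def dualObj {d n m : ℕ} (x : Fin n → EuclideanSpace ℝ (Fin d))
    (y : Fin m → EuclideanSpace ℝ (Fin d)) (μ : Fin n → ℝ) (ν : Fin m → ℝ) (s : ℝ)
    (α : Fin n → ℝ) (β : Fin m → ℝ) : ℝ :=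
  ∑ i, μ i * α i - ∑ j, ν j * β j -
    Cs s * ∑ i, ∑ j, μ i * ν j * (max (α i - β j) 0 / ‖x i - y j‖) ^ s

theorem Cs_nonneg {s : ℝ} (hs : 1 ≤ s) : 0 ≤ Cs s := by
  have h : 1 / s ≤ 1 := (div_le_one (by linarith)).2 hs
  exact mul_nonneg (by positivity) (Real.rpow_nonneg (by linarith) _)

theorem rpow_add_mul_sub_le_rpow {s a b : ℝ} (hs : 1 < s) (ha : 0 ≤ a) (hb : 0 ≤ b) :
    a ^ s + s * a ^ (s - 1) * (b - a) ≤ b ^ s := by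
  rcases ha.eq_or_lt with rfl | ha
  · rw [Real.zero_rpow (by linarith), Real.zero_rpow (by linarith)]
    simpa using Real.rpow_nonneg hb s
  have h := one_add_mul_self_le_rpow_one_add (s := b / a - 1) (p := s)
    (by linarith [div_nonneg hb ha.le]) hs.le
  rw [add_sub_cancel, Real.div_rpow hb ha.le, le_div_iff₀ (Real.rpow_pos_of_pos ha s)] at h
  have e : a ^ s = a ^ (s - 1) * a := by
    rw [← Real.rpow_add_one ha.ne', sub_add_cancel]
  refine le_of_eq_of_le ?_ h
  rw [e]
  field_simp

theorem rpow_posPart_add_mul_sub_le {s a b : ℝ} (hs : 1 < s) :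
    max a 0 ^ s + s * max a 0 ^ (s - 1) * (b - a) ≤ max b 0 ^ s := by
  refine le_trans ?_ (rpow_add_mul_sub_le_rpow hs (le_max_right a 0) (le_max_right b 0))
  rcases le_or_gt a 0 with ha | ha
  · rw [max_eq_right ha, Real.zero_rpow (by linarith : s - 1 ≠ 0)]
    simp
  · rw [max_eq_left ha.le]
    gcongr
    exact le_max_left b 0

/-- The supergradient inequality for the concave function `dualObj`. -/
theorem dualObj_sub_le {d n m : ℕ} (x : Fin n → EuclideanSpace ℝ (Fin d))
    (y : Fin m → EuclideanSpace ℝ (Fin d)) {s : ℝ} (hs : 1 < s)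
    (μ : Fin n → ℝ) (ν : Fin m → ℝ) (hμ : ∀ i, 0 ≤ μ i) (hν : ∀ j, 0 ≤ ν j)
    (α α' : Fin n → ℝ) (β β' : Fin m → ℝ) :
    dualObj x y μ ν s α' β' - dualObj x y μ ν s α β ≤
      ∑ i, μ i * ((1 - s * Cs s *
          ∑ j, ν j * (max (α i - β j) 0 ^ (s - 1) / ‖x i - y j‖ ^ s)) * (α' i - α i)) +
        ∑ j, ν j * ((1 - s * Cs s *
          ∑ i, μ i * (max (α i - β j) 0 ^ (s - 1) / ‖x i - y j‖ ^ s)) * (β j - β' j)) := by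
  have hpair : ∀ i j, μ i * ν j * (max (α i - β j) 0 / ‖x i - y j‖) ^ s +
      s * (μ i * ν j * (max (α i - β j) 0 ^ (s - 1) / ‖x i - y j‖ ^ s)) *
        ((α' i - α i) + (β j - β' j)) ≤
      μ i * ν j * (max (α' i - β' j) 0 / ‖x i - y j‖) ^ s := by
    intro i j
    rw [Real.div_rpow (le_max_right _ _) (norm_nonneg _),
      Real.div_rpow (le_max_right _ _) (norm_nonneg _)]
    have h := mul_le_mul_of_nonneg_left
      (rpow_posPart_add_mul_sub_le (a := α i - β j) (b := α' i - β' j) hs)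
      (div_nonneg (mul_nonneg (hμ i) (hν j)) (Real.rpow_nonneg (norm_nonneg (x i - y j)) s))
    refine le_of_eq_of_le ?_ (h.trans_eq ?_) <;> ring
  have hsum := mul_le_mul_of_nonneg_left
    (sum_le_sum fun i (_ : i ∈ univ) => sum_le_sum fun j (_ : j ∈ univ) => hpair i j)
    (Cs_nonneg hs.le)
  have hα : ∑ i, μ i * ((1 - s * Cs s *
      ∑ j, ν j * (max (α i - β j) 0 ^ (s - 1) / ‖x i - y j‖ ^ s)) * (α' i - α i)) =
      ∑ i, μ i * α' i - ∑ i, μ i * α i - Cs s * ∑ i, ∑ j,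
        s * (μ i * ν j * (max (α i - β j) 0 ^ (s - 1) / ‖x i - y j‖ ^ s)) * (α' i - α i) := by
    rw [mul_sum, ← sum_sub_distrib, ← sum_sub_distrib]
    refine sum_congr rfl fun i _ => ?_
    have h : Cs s * ∑ j,
        s * (μ i * ν j * (max (α i - β j) 0 ^ (s - 1) / ‖x i - y j‖ ^ s)) * (α' i - α i) =
        μ i * (s * Cs s *
          ∑ j, ν j * (max (α i - β j) 0 ^ (s - 1) / ‖x i - y j‖ ^ s)) * (α' i - α i) := by
      simp only [mul_sum, sum_mul]
      exact sum_congr rfl fun j _ => by ring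
    rw [h]
    ring
  have hβ : ∑ j, ν j * ((1 - s * Cs s *
      ∑ i, μ i * (max (α i - β j) 0 ^ (s - 1) / ‖x i - y j‖ ^ s)) * (β j - β' j)) =
      ∑ j, ν j * β j - ∑ j, ν j * β' j - Cs s * ∑ i, ∑ j,
        s * (μ i * ν j * (max (α i - β j) 0 ^ (s - 1) / ‖x i - y j‖ ^ s)) * (β j - β' j) := by
    rw [sum_comm (s := (univ : Finset (Fin n))), mul_sum, ← sum_sub_distrib, ← sum_sub_distrib]
    refine sum_congr rfl fun j _ => ?_
    have h : Cs s * ∑ i,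
        s * (μ i * ν j * (max (α i - β j) 0 ^ (s - 1) / ‖x i - y j‖ ^ s)) * (β j - β' j) =
        ν j * (s * Cs s *
          ∑ i, μ i * (max (α i - β j) 0 ^ (s - 1) / ‖x i - y j‖ ^ s)) * (β j - β' j) := by
      simp only [mul_sum, sum_mul]
      exact sum_congr rfl fun i _ => by ring
    rw [h]
    ring
  rw [hα, hβ]
  simp only [mul_add, sum_add_distrib] at hsum
  unfold dualObj
  linarith

theorem sum_mul_mul_sub_le {ι : Type*} [Fintype ι] (w c u v : ι → ℝ) (hw : ∀ i, 0 ≤ w i) :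
    ∑ i, w i * (c i * (u i - v i)) ≤ (‖u‖ + ‖v‖) * ∑ i, w i * |c i| := by
  rw [mul_sum]
  refine sum_le_sum fun i _ => ?_
  have h : |u i - v i| ≤ ‖u‖ + ‖v‖ :=
    (abs_sub (u i) (v i)).trans (add_le_add (norm_le_pi_norm u i) (norm_le_pi_norm v i))
  calc w i * (c i * (u i - v i)) ≤ w i * (|c i| * (‖u‖ + ‖v‖)) := by
        refine mul_le_mul_of_nonneg_left ((le_abs_self _).trans ?_) (hw i)
        rw [abs_mul]
        exact mul_le_mul_of_nonneg_left h (abs_nonneg _)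
    _ = (‖u‖ + ‖v‖) * (w i * |c i|) := by ring

/-- dual gap bound at approximate stationarity. (For `α : Fin n → ℝ` the norm
`‖α‖` is the sup norm `max_i |α i|`, i.e., the ℓ∞ norm.) -/
theorem dual_gap_bound {d n m : ℕ} (x : Fin n → EuclideanSpace ℝ (Fin d))
    (y : Fin m → EuclideanSpace ℝ (Fin d)) (ρ s : ℝ) (hρ : 1 < ρ) (hs : 1 < s)
    (hconj : 1 / ρ + 1 / s = 1)
    (μ : Fin n → ℝ) (ν : Fin m → ℝ)
    (hμ0 : ∀ i, 0 < μ i) (hν0 : ∀ j, 0 < ν j)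
    (hμ1 : ∑ i, μ i = 1) (hν1 : ∑ j, ν j = 1)
    (hdisj : ∀ i j, x i ≠ y j)
    (α αstar : Fin n → ℝ) (β βstar : Fin m → ℝ) :
    dualObj x y μ ν s αstar βstar - dualObj x y μ ν s α β ≤
      (‖α‖ + ‖αstar‖) *
          ∑ i, μ i *
            |1 - s * Cs s * ∑ j, ν j * (max (α i - β j) 0 ^ (s - 1) / ‖x i - y j‖ ^ s)| +
        (‖β‖ + ‖βstar‖) *
          ∑ j, ν j *
            |1 - s * Cs s * ∑ i, μ i * (max (α i - β j) 0 ^ (s - 1) / ‖x i - y j‖ ^ s)| := by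
  refine (dualObj_sub_le x y hs μ ν (fun i => (hμ0 i).le) (fun j => (hν0 j).le)
    α αstar β βstar).trans (add_le_add ?_ ?_)
  · rw [add_comm ‖α‖]
    exact sum_mul_mul_sub_le μ _ αstar α fun i => (hμ0 i).le
  · exact sum_mul_mul_sub_le ν _ β βstar fun j => (hν0 j).le
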